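/- arXiv:2402.15113 — 2 statements merged into one kernel-verified Lean document; each statement's English description precedes it below -/
import Mathlib

section
/- Let E be a real inner product space and f : E → ℝ differentiable with L_f-Lipschitz gradient, L_f > 0. Let W, g ∈ E, δ = g − ∇f(W), and let the step size satisfy 0 < η ≤ 1/L_f. Assume the stale-gradient error satisfies the staleness bound ‖δ‖² ≤ ρ ε_s and is non-obtuse to the true gradient, ⟪δ, ∇f(W)⟫ ≥ 0. Then f(W − η g) − f(W) ≤ −(η − (L_f/2)η²)·‖∇f(W)‖² + (L_f η²/2)·ρ ε_s. (The per-step inequality of the paper's Theorem 1 proof, made precise: under these hypotheses the dropped cross term (L_f η² − η)⟪δ, ∇f(W)⟫ is nonpositive.) -/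
open RealInnerProductSpace

/-- The quadratic upper bound for a function with `L`-Lipschitz gradient. -/
theorem le_add_inner_gradient_add_sq {E : Type*} [NormedAddCommGroup E]
    [InnerProductSpace ℝ E] [CompleteSpace E] {f : E → ℝ} {L : ℝ} (hf : Differentiable ℝ f)
    (hgrad : ∀ x y : E, ‖gradient f x - gradient f y‖ ≤ L * ‖x - y‖) (x v : E) :
    f (x + v) ≤ f x + inner ℝ (gradient f x) v + L / 2 * ‖v‖ ^ 2 := by
  have hφ (t : ℝ) : HasDerivAt (fun s : ℝ => f (x + s • v))
      (inner ℝ (gradient f (x + t • v)) v) t := by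
    have hline : HasDerivAt (fun s : ℝ => x + s • v) v t := by
      simpa using ((hasDerivAt_id t).smul_const v).const_add x
    rw [inner_gradient_left]
    exact (hf (x + t • v)).hasFDerivAt.comp_hasDerivAt t hline
  have hB (t : ℝ) : HasDerivAt
      (fun s : ℝ => f x + s * inner ℝ (gradient f x) v + L / 2 * ‖v‖ ^ 2 * s ^ 2)
      (inner ℝ (gradient f x) v + L * ‖v‖ ^ 2 * t) t := by
    have h := (((hasDerivAt_id t).mul_const (inner ℝ (gradient f x) v)).const_add (f x)).add
      ((hasDerivAt_pow 2 t).const_mul (L / 2 * ‖v‖ ^ 2))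
    refine h.congr_deriv ?_
    norm_num
    ring
  have key := image_le_of_deriv_right_le_deriv_boundary (a := 0) (b := 1)
    (fun t _ => (hφ t).continuousAt.continuousWithinAt)
    (fun t _ => (hφ t).hasDerivWithinAt) (by simp)
    (fun t _ => (hB t).continuousAt.continuousWithinAt)
    (fun t _ => (hB t).hasDerivWithinAt)
    (fun t ht => by
      have hlip : ‖gradient f (x + t • v) - gradient f x‖ ≤ L * (t * ‖v‖) := by
        simpa [norm_smul, abs_of_nonneg ht.1] using hgrad (x + t • v) x
      have hinner := real_inner_le_norm (gradient f (x + t • v) - gradient f x) v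
      rw [inner_sub_left] at hinner
      have hmul := mul_le_mul_of_nonneg_right hlip (norm_nonneg v)
      linarith)
    (Set.right_mem_Icc.mpr zero_le_one)
  simpa using key

/-- Per-step inequality of Theorem 1's proof made precise: if `0 < η ≤ 1/L_f`,
`‖δ‖² ≤ ρ εs` and `⟪δ, ∇f W⟫ ≥ 0` with `δ = g - ∇f W`, then
`f (W - η • g) - f W ≤ -(η - (L_f/2)η²)‖∇f W‖² + (L_f η²/2) ρ εs`. -/
theorem one_step_stale {E : Type*} [NormedAddCommGroup E] [InnerProductSpace ℝ E]
    [CompleteSpace E] (f : E → ℝ) (Lf ρ εs : ℝ) (hLf : 0 < Lf)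
    (hf : Differentiable ℝ f)
    (hgrad : ∀ x y : E, ‖gradient f x - gradient f y‖ ≤ Lf * ‖x - y‖)
    (W g : E) (η : ℝ) (hη₀ : 0 < η) (hη₁ : η ≤ 1 / Lf)
    (hδ : ‖g - gradient f W‖ ^ 2 ≤ ρ * εs)
    (halign : 0 ≤ ⟪g - gradient f W, gradient f W⟫) :
    f (W - η • g) - f W ≤
      -(η - Lf / 2 * η ^ 2) * ‖gradient f W‖ ^ 2 + Lf * η ^ 2 / 2 * (ρ * εs) := by
  have hdesc := le_add_inner_gradient_add_sq hf hgrad W (-(η • g))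
  set G := gradient f W with hG
  obtain ⟨δ, rfl⟩ : ∃ δ, g = G + δ := ⟨g - G, by abel⟩
  rw [add_sub_cancel_left] at hδ halign
  rw [← sub_eq_add_neg, norm_neg, norm_smul, mul_pow, Real.norm_eq_abs, sq_abs, inner_neg_right,
    real_inner_smul_right, inner_add_right, real_inner_self_eq_norm_sq, norm_add_sq_real,
    real_inner_comm δ G] at hdesc
  have hηL : η * Lf ≤ 1 := (le_div_iff₀ hLf).mp hη₁
  have hcross := mul_nonneg (mul_nonneg hη₀.le (sub_nonneg.mpr hηL)) halign
  have herr := mul_le_mul_of_nonneg_left hδ (by positivity : 0 ≤ Lf * η ^ 2 / 2)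
  linarith
end

section
/- Let E be a real inner product space and f : E → ℝ differentiable with L_f-Lipschitz gradient, L_f > 0. Consider iterates W_0, W_1, …, W_T in E with W_{t+1} = W_t − η_t g_t for t = 0, …, T−1, where each step size satisfies 0 < η_t ≤ 1/L_f, and each gradient error δ_t = g_t − ∇f(W_t) satisfies ‖δ_t‖² ≤ ρ ε_s and ⟪δ_t, ∇f(W_t)⟫ ≥ 0. Then, with c = L_f ρ ε_s / 2, the telescoped descent inequality holds: ∑_{t=0}^{T−1} (η_t − (L_f/2)η_t²)·‖∇f(W_t)‖² ≤ f(W_0) − f(W_T) + c·∑_{t=0}^{T−1} η_t². (The telescoping-sum inequality in the proof of the paper's Theorem 1.) -/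
open RealInnerProductSpace

/-- The descent lemma: a function with `L`-Lipschitz gradient is bounded above by its quadratic
model. -/
theorem le_quadratic_of_lipschitz_gradient {E : Type*} [NormedAddCommGroup E]
    [InnerProductSpace ℝ E] [CompleteSpace E] {f : E → ℝ} {L : ℝ} (hf : Differentiable ℝ f)
    (hgrad : ∀ x y : E, ‖gradient f x - gradient f y‖ ≤ L * ‖x - y‖) (x v : E) :
    f (x + v) ≤ f x + ⟪gradient f x, v⟫ + L / 2 * ‖v‖ ^ 2 := by
  have hline (s : ℝ) : HasDerivAt (fun s : ℝ => x + s • v) v s := by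
    simpa using ((hasDerivAt_id s).smul_const v).const_add x
  have hder (s : ℝ) : HasDerivAt
      (fun s : ℝ => f (x + s • v) - s * ⟪gradient f x, v⟫ - L / 2 * ‖v‖ ^ 2 * s ^ 2)
      (⟪gradient f (x + s • v), v⟫ - ⟪gradient f x, v⟫ - L * ‖v‖ ^ 2 * s) s := by
    have h := (hf (x + s • v)).hasGradientAt.hasFDerivAt.comp_hasDerivAt s (hline s)
    rw [InnerProductSpace.toDual_apply_apply] at h
    refine ((h.sub ((hasDerivAt_id s).mul_const ⟪gradient f x, v⟫)).sub
      ((hasDerivAt_pow 2 s).const_mul (L / 2 * ‖v‖ ^ 2))).congr_deriv ?_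
    simp
    ring
  have hanti := antitoneOn_of_deriv_nonpos (convex_Icc (0 : ℝ) 1)
    (fun s _ => (hder s).continuousAt.continuousWithinAt)
    (fun s _ => (hder s).differentiableAt.differentiableWithinAt) (fun s hs => by
      rw [interior_Icc] at hs
      rw [(hder s).deriv, ← inner_sub_left]
      have h₁ := real_inner_le_norm (gradient f (x + s • v) - gradient f x) v
      have h₂ := hgrad (x + s • v) x
      rw [add_sub_cancel_left, norm_smul, Real.norm_of_nonneg hs.1.le] at h₂
      nlinarith [mul_le_mul_of_nonneg_right h₂ (norm_nonneg v)])
  have h := hanti (Set.left_mem_Icc.2 zero_le_one) (Set.right_mem_Icc.2 zero_le_one) zero_le_one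
  simp only [one_smul, zero_smul, add_zero, one_mul, zero_mul, one_pow] at h
  linarith

/-- One step of gradient descent with an inexact gradient `g` whose error is aligned with the
true gradient. -/
theorem inexact_gradient_step {E : Type*} [NormedAddCommGroup E]
    [InnerProductSpace ℝ E] [CompleteSpace E] {f : E → ℝ} {L : ℝ} (hL : 0 < L)
    (hf : Differentiable ℝ f)
    (hgrad : ∀ x y : E, ‖gradient f x - gradient f y‖ ≤ L * ‖x - y‖) {x g : E} {r B : ℝ}
    (hr₀ : 0 ≤ r) (hr₁ : r ≤ 1 / L) (hB : ‖g - gradient f x‖ ^ 2 ≤ B)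
    (halign : 0 ≤ ⟪g - gradient f x, gradient f x⟫) :
    (r - L / 2 * r ^ 2) * ‖gradient f x‖ ^ 2 ≤
      f x - f (x - r • g) + L * B / 2 * r ^ 2 := by
  have h := le_quadratic_of_lipschitz_gradient hf hgrad x (-(r • g))
  rw [← sub_eq_add_neg, inner_neg_right, inner_smul_right, norm_neg, norm_smul, mul_pow,
    Real.norm_eq_abs, sq_abs] at h
  obtain ⟨d, rfl⟩ : ∃ d, g = gradient f x + d := ⟨g - gradient f x, by abel⟩
  rw [add_sub_cancel_left] at hB halign
  rw [norm_add_sq_real, inner_add_right, real_inner_self_eq_norm_sq] at h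
  rw [real_inner_comm] at halign
  have hrL : r * L ≤ 1 := (le_div_iff₀ hL).1 hr₁
  have h₁ : 0 ≤ r * (1 - r * L) * ⟪gradient f x, d⟫ :=
    mul_nonneg (mul_nonneg hr₀ (by linarith)) halign
  have h₂ : L / 2 * r ^ 2 * ‖d‖ ^ 2 ≤ L / 2 * r ^ 2 * B :=
    mul_le_mul_of_nonneg_left hB (by positivity)
  linarith

/-- Telescoped descent inequality in the proof of Theorem 1: summing the per-step
inequalities over `t = 0, …, T-1` gives, with `c = L_f ρ εs / 2`,
`∑ (η_t - (L_f/2)η_t²)‖∇f W_t‖² ≤ f W_0 - f W_T + c ∑ η_t²`. -/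
theorem telescoped_descent {E : Type*} [NormedAddCommGroup E] [InnerProductSpace ℝ E]
    [CompleteSpace E] (f : E → ℝ) (Lf ρ εs : ℝ) (hLf : 0 < Lf)
    (hf : Differentiable ℝ f)
    (hgrad : ∀ x y : E, ‖gradient f x - gradient f y‖ ≤ Lf * ‖x - y‖)
    (T : ℕ) (W g : ℕ → E) (η : ℕ → ℝ)
    (hstep : ∀ t < T, W (t + 1) = W t - η t • g t)
    (hη₀ : ∀ t < T, 0 < η t) (hη₁ : ∀ t < T, η t ≤ 1 / Lf)
    (hδ : ∀ t < T, ‖g t - gradient f (W t)‖ ^ 2 ≤ ρ * εs)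
    (halign : ∀ t < T, 0 ≤ ⟪g t - gradient f (W t), gradient f (W t)⟫) :
    ∑ t ∈ Finset.range T, (η t - Lf / 2 * η t ^ 2) * ‖gradient f (W t)‖ ^ 2 ≤
      f (W 0) - f (W T) + Lf * ρ * εs / 2 * ∑ t ∈ Finset.range T, η t ^ 2 := by
  rw [← Finset.sum_range_sub' (fun t => f (W t)), Finset.mul_sum, ← Finset.sum_add_distrib]
  refine Finset.sum_le_sum fun t ht => ?_
  have ht := Finset.mem_range.1 ht
  rw [hstep t ht, mul_assoc Lf ρ εs]
  exact inexact_gradient_step hLf hf hgrad (hη₀ t ht).le (hη₁ t ht) (hδ t ht) (halign t ht)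
end
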